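/- arXiv:1102.1138 — 2 statements merged into one kernel-verified Lean document; each statement's English description precedes it below -/
import Mathlib

section
/- In a finite bipartite graph G=(A,B,E), if X = ker_A(G) (the unique minimal A-critical set, i.e., the intersection of all A-critical sets, which is itself A-critical) and Y⊆B is any B-critical set, then X∩N(Y) = ∅ and N(X)∩Y = ∅. -/
open Finset

open scoped Classical

variable {V : Type*} [Fintype V] [DecidableEq V]

/-- The neighborhood `N(X)` of a finite set of vertices `X`. -/
noncomputable def nbr (G : SimpleGraph V) (X : Finset V) : Finset V :=
  Finset.univ.filter fun v => ∃ x ∈ X, G.Adj v x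

/-- The difference `d(X) = |X| - |N(X)|` of a set of vertices. -/
noncomputable def diffZ (G : SimpleGraph V) (X : Finset V) : ℤ :=
  (X.card : ℤ) - ((nbr G X).card : ℤ)

/-- The critical difference `d_c(G) = max {d(X) : X ⊆ V}`. -/
noncomputable def critDiff (G : SimpleGraph V) : ℤ :=
  (Finset.univ : Finset V).powerset.sup' (Finset.powerset_nonempty _) (diffZ G)

/-- A set of vertices is independent if no two of its vertices are adjacent. -/
def IsIndep (G : SimpleGraph V) (S : Finset V) : Prop :=
  ∀ u ∈ S, ∀ v ∈ S, ¬ G.Adj u v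

/-- The independence number `α(G)`. -/
noncomputable def indepNum (G : SimpleGraph V) : ℕ :=
  ((Finset.univ : Finset V).powerset.filter (IsIndep G)).sup Finset.card

/-- The critical independence difference `id_c(G) = max {d(I) : I independent}`. -/
noncomputable def idc (G : SimpleGraph V) : ℤ :=
  ((Finset.univ : Finset V).powerset.filter (IsIndep G)).sup'
    ⟨∅, by simp [IsIndep]⟩ (diffZ G)

/-- A critical independent set: an independent set `S` with `d(S) = id_c(G)`. -/
def CritIndep (G : SimpleGraph V) (S : Finset V) : Prop :=
  IsIndep G S ∧ diffZ G S = idc G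

/-- A finite set of edges of `G` that are pairwise non-incident (a matching). -/
def IsMatchingSet (G : SimpleGraph V) (M : Finset (Sym2 V)) : Prop :=
  (∀ e ∈ M, e ∈ G.edgeSet) ∧
    (M : Set (Sym2 V)).Pairwise fun e f => ∀ v : V, ¬(v ∈ e ∧ v ∈ f)

/-- The matching number `μ(G)`. -/
noncomputable def matchNum (G : SimpleGraph V) : ℕ :=
  ((Finset.univ : Finset (Sym2 V)).powerset.filter (IsMatchingSet G)).sup Finset.card

/-- A maximum independent set. -/
def IsMaxIndep (G : SimpleGraph V) (S : Finset V) : Prop :=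
  IsIndep G S ∧ S.card = indepNum G

/-- `ker(G)`: the intersection of all critical independent sets. -/
noncomputable def kerSet (G : SimpleGraph V) : Finset V :=
  Finset.univ.filter fun v => ∀ S : Finset V, CritIndep G S → v ∈ S

/-- `diadem(G)`: the union of all critical independent sets. -/
noncomputable def diademSet (G : SimpleGraph V) : Finset V :=
  Finset.univ.filter fun v => ∃ S : Finset V, CritIndep G S ∧ v ∈ S

/-- `core(G)`: the intersection of all maximum independent sets. -/
noncomputable def coreSet (G : SimpleGraph V) : Finset V :=
  Finset.univ.filter fun v => ∀ S : Finset V, IsMaxIndep G S → v ∈ S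

/-- `corona(G)`: the union of all maximum independent sets. -/
noncomputable def coronaSet (G : SimpleGraph V) : Finset V :=
  Finset.univ.filter fun v => ∃ S : Finset V, IsMaxIndep G S ∧ v ∈ S

/-- `δ₀(A) = max {δ(X) : X ⊆ A}`, the maximum deficiency over subsets of a side. -/
noncomputable def delta0 (G : SimpleGraph V) (A : Finset V) : ℤ :=
  A.powerset.sup' (Finset.powerset_nonempty _) (diffZ G)

/-- An `A`-critical set: a subset `X ⊆ A` with `δ(X) = δ₀(A)`. -/
def SideCrit (G : SimpleGraph V) (A X : Finset V) : Prop :=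
  X ⊆ A ∧ diffZ G X = delta0 G A

/-- `ker_A(G)`: the intersection of all `A`-critical sets. -/
noncomputable def kerSide (G : SimpleGraph V) (A : Finset V) : Finset V :=
  Finset.univ.filter fun v => ∀ X : Finset V, SideCrit G A X → v ∈ X

/-- `diadem_A(G)`: the union of all `A`-critical sets. -/
noncomputable def diademSide (G : SimpleGraph V) (A : Finset V) : Finset V :=
  Finset.univ.filter fun v => ∃ X : Finset V, SideCrit G A X ∧ v ∈ X

/-- `{A, B}` is a bipartition of `G`: both sides nonempty, disjoint, covering all
vertices, and every edge goes between `A` and `B`. -/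
def IsBipartition (G : SimpleGraph V) (A B : Finset V) : Prop :=
  A.Nonempty ∧ B.Nonempty ∧ Disjoint A B ∧ A ∪ B = Finset.univ ∧
    ∀ u v : V, G.Adj u v → (u ∈ A ∧ v ∈ B) ∨ (u ∈ B ∧ v ∈ A)

theorem IsBipartition.symm {G : SimpleGraph V} {A B : Finset V} (h : IsBipartition G A B) :
    IsBipartition G B A := by
  obtain ⟨hA, hB, hd, hu, he⟩ := h
  exact ⟨hB, hA, hd.symm, by rw [union_comm, hu], fun u v huv => (he u v huv).symm⟩

theorem diffZ_le_delta0 (G : SimpleGraph V) {A X : Finset V} (hX : X ⊆ A) :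
    diffZ G X ≤ delta0 G A :=
  le_sup' (diffZ G) (mem_powerset.2 hX)

theorem IsBipartition.nbr_subset {G : SimpleGraph V} {A B Y : Finset V}
    (h : IsBipartition G A B) (hY : Y ⊆ B) : nbr G Y ⊆ A := by
  obtain ⟨-, -, hd, -, he⟩ := h
  intro v hv
  obtain ⟨y, hy, hvy⟩ := (mem_filter.1 hv).2
  rcases he v y hvy with h | h
  · exact h.1
  · exact (disjoint_left.1 hd h.2 (hY hy)).elim

theorem IsBipartition.nbr_sdiff_nbr_subset {G : SimpleGraph V} {A B : Finset V}
    (h : IsBipartition G A B) (Y : Finset V) : nbr G (A \ nbr G Y) ⊆ B \ Y := by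
  intro v hv
  refine mem_sdiff.2 ⟨h.symm.nbr_subset sdiff_subset hv, fun hvY => ?_⟩
  obtain ⟨x, hx, hvx⟩ := (mem_filter.1 hv).2
  exact (mem_sdiff.1 hx).2 (mem_filter.2 ⟨mem_univ _, v, hvY, hvx.symm⟩)

/-- Passing from `Y ⊆ B` to `A \ N(Y)` raises the deficiency by at least `|A| - |B|`. -/
theorem IsBipartition.diffZ_add_le_diffZ_sdiff_nbr {G : SimpleGraph V} {A B Y : Finset V}
    (h : IsBipartition G A B) (hY : Y ⊆ B) :
    diffZ G Y + A.card - B.card ≤ diffZ G (A \ nbr G Y) := by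
  have hcard := card_le_card (h.nbr_sdiff_nbr_subset Y)
  have hA := card_sdiff_add_card_eq_card (h.nbr_subset hY)
  have hB := card_sdiff_add_card_eq_card hY
  unfold diffZ
  omega

/-- The non-neighbors in `A` of a `B`-critical set form an `A`-critical set. -/
theorem SideCrit.sdiff_nbr {G : SimpleGraph V} {A B Y : Finset V}
    (hY : SideCrit G B Y) (h : IsBipartition G A B) : SideCrit G A (A \ nbr G Y) := by
  refine ⟨sdiff_subset, le_antisymm (diffZ_le_delta0 G sdiff_subset) ?_⟩
  refine sup'_le _ _ fun Z hZ => ?_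
  have hYA := h.diffZ_add_le_diffZ_sdiff_nbr hY.1
  have hZB := h.symm.diffZ_add_le_diffZ_sdiff_nbr (mem_powerset.1 hZ)
  have hmax := diffZ_le_delta0 G (sdiff_subset : B \ nbr G Z ⊆ B)
  have hcrit := hY.2
  omega

/-- In a finite bipartite graph, if `X = ker_A(G)` and `Y` is any `B`-critical
set, then `X ∩ N(Y) = ∅` and `N(X) ∩ Y = ∅`. -/
theorem kerSideA_inter_nbr_sideCritB (G : SimpleGraph V) (A B : Finset V)
    (hbip : IsBipartition G A B) (X Y : Finset V)
    (hX : X = kerSide G A) (hY : SideCrit G B Y) :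
    X ∩ nbr G Y = ∅ ∧ nbr G X ∩ Y = ∅ := by
  subst hX
  have hker : ∀ x ∈ kerSide G A, x ∉ nbr G Y := fun x hx =>
    (mem_sdiff.1 ((mem_filter.1 hx).2 _ (hY.sdiff_nbr hbip))).2
  refine ⟨disjoint_iff_inter_eq_empty.1 (disjoint_left.2 hker),
    disjoint_iff_inter_eq_empty.1 (disjoint_left.2 fun v hv hvY => ?_)⟩
  obtain ⟨x, hx, hvx⟩ := (mem_filter.1 hv).2
  exact hker x hx (mem_filter.2 ⟨mem_univ _, v, hvY, hvx.symm⟩)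
end

section
/- For every finite simple graph G, diadem(G) ⊆ corona(G), i.e., the union of all critical independent sets is contained in the union of all maximum independent sets. -/
open Finset

open scoped Classical

variable {V : Type*} [Fintype V] [DecidableEq V]

theorem mem_nbr {G : SimpleGraph V} {X : Finset V} {v : V} :
    v ∈ nbr G X ↔ ∃ x ∈ X, G.Adj v x := by
  simp [nbr]

theorem IsIndep.mono {G : SimpleGraph V} {S T : Finset V} (hT : IsIndep G T) (h : S ⊆ T) :
    IsIndep G S :=
  fun u hu v hv => hT u (h hu) v (h hv)

theorem IsIndep.disjoint_nbr {G : SimpleGraph V} {S : Finset V} (hS : IsIndep G S) :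
    Disjoint S (nbr G S) := by
  rw [Finset.disjoint_left]
  intro v hv hn
  obtain ⟨x, hx, hvx⟩ := mem_nbr.1 hn
  exact hS v hv x hx hvx

theorem IsIndep.card_le_indepNum {G : SimpleGraph V} {S : Finset V} (hS : IsIndep G S) :
    S.card ≤ indepNum G :=
  Finset.le_sup (f := Finset.card) (by simp [hS])

theorem IsIndep.diffZ_le_idc {G : SimpleGraph V} {S : Finset V} (hS : IsIndep G S) :
    diffZ G S ≤ idc G :=
  Finset.le_sup' (diffZ G) (by simp [hS])

theorem exists_isMaxIndep (G : SimpleGraph V) : ∃ S, IsMaxIndep G S := by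
  obtain ⟨S, hS, h⟩ := Finset.exists_mem_eq_sup
    ((Finset.univ : Finset V).powerset.filter (IsIndep G)) ⟨∅, by simp [IsIndep]⟩ Finset.card
  exact ⟨S, (Finset.mem_filter.1 hS).2, h.symm⟩

/-- Replacing the part of an independent set `I` that meets `N(S)` by `S` keeps it independent. -/
theorem IsIndep.union_sdiff_nbr {G : SimpleGraph V} {S I : Finset V} (hS : IsIndep G S)
    (hI : IsIndep G I) : IsIndep G (S ∪ I \ nbr G S) := by
  intro u hu v hv huv
  simp only [Finset.mem_union, Finset.mem_sdiff, mem_nbr] at hu hv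
  rcases hu with hu | ⟨hu, hu'⟩ <;> rcases hv with hv | ⟨hv, hv'⟩
  · exact hS u hu v hv huv
  · exact hv' ⟨u, hu, huv.symm⟩
  · exact hu' ⟨v, hv, huv⟩
  · exact hI u hu v hv huv

/-- The neighbors of a critical independent set `S` lying in an independent set `I` are at most
as many as the vertices of `S` outside `I`. -/
theorem CritIndep.card_nbr_inter_le {G : SimpleGraph V} {S I : Finset V} (hS : CritIndep G S)
    (hI : IsIndep G I) : (nbr G S ∩ I).card ≤ (S \ I).card := by
  have hle : diffZ G (S ∩ I) ≤ diffZ G S :=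
    hS.2 ▸ (hI.mono Finset.inter_subset_right).diffZ_le_idc
  have hsub : nbr G (S ∩ I) ⊆ nbr G S \ I := by
    intro v hv
    obtain ⟨x, hx, hvx⟩ := mem_nbr.1 hv
    rw [Finset.mem_inter] at hx
    exact Finset.mem_sdiff.2 ⟨mem_nbr.2 ⟨x, hx.1, hvx⟩, fun hvI => hI v hvI x hx.2 hvx⟩
  have hcard := Finset.card_le_card hsub
  have hN := Finset.card_sdiff_add_card_inter (nbr G S) I
  have hSI := Finset.card_sdiff_add_card_inter S I
  simp only [diffZ] at hle
  omega

/-- Every critical independent set is contained in a maximum independent set. -/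
theorem CritIndep.exists_isMaxIndep_superset {G : SimpleGraph V} {S : Finset V}
    (hS : CritIndep G S) : ∃ T, IsMaxIndep G T ∧ S ⊆ T := by
  obtain ⟨I, hI, hIcard⟩ := exists_isMaxIndep G
  have hT := hS.1.union_sdiff_nbr hI
  refine ⟨S ∪ I \ nbr G S, ⟨hT, hT.card_le_indepNum.antisymm ?_⟩, Finset.subset_union_left⟩
  have hunion : S ∪ I \ nbr G S = (S ∪ I) \ nbr G S := by
    rw [Finset.union_sdiff_distrib, Finset.sdiff_eq_self_of_disjoint hS.1.disjoint_nbr]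
  have hinter : (S ∪ I) ∩ nbr G S = nbr G S ∩ I := by
    rw [Finset.union_inter_distrib_right, Finset.disjoint_iff_inter_eq_empty.1 hS.1.disjoint_nbr,
      Finset.empty_union, Finset.inter_comm]
  have hle := hS.card_nbr_inter_le hI
  have hcard := Finset.card_sdiff_add_card_inter (S ∪ I) (nbr G S)
  have hSI := Finset.card_sdiff_add_card S I
  rw [hinter] at hcard
  rw [hunion]
  omega

/-- For every finite simple graph, `diadem(G) ⊆ corona(G)`. -/
theorem diademSet_subset_coronaSet (G : SimpleGraph V) :
    diademSet G ⊆ coronaSet G := by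
  intro v hv
  obtain ⟨S, hS, hvS⟩ := (Finset.mem_filter.1 hv).2
  obtain ⟨T, hT, hST⟩ := hS.exists_isMaxIndep_superset
  exact Finset.mem_filter.2 ⟨Finset.mem_univ v, T, hT, hST hvS⟩
end
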